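/- arXiv:2306.11929 — 8 statements merged into one kernel-verified Lean document; each statement's English description precedes it below -/
import Mathlib

section
/- Let x : ℕ → ℝ be a sequence with x₀ > 0, x₁ > 0, x₂ > 0 and satisfying x_{n+3} = x_{n+1}/(x_{n+1} + x_n) for all n ≥ 0. Then there exists φ ∈ [0,1] such that the even-indexed subsequence converges to φ and the odd-indexed subsequence converges to 1 − φ, i.e. lim_{n→∞} x_{2n} = φ and lim_{n→∞} x_{2n+1} = 1 − φ. -/
/-- Amleh–Ladas Conjecture 1: every positive solution of
`x_{n+3} = x_{n+1}/(x_{n+1}+x_n)` converges to a period-two solution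
`…, φ, 1-φ, …` with `0 ≤ φ ≤ 1`. -/
theorem amleh_ladas_conj1 (x : ℕ → ℝ)
    (h0 : x 0 > 0) (h1 : x 1 > 0) (h2 : x 2 > 0)
    (hrec : ∀ n : ℕ, x (n + 3) = x (n + 1) / (x (n + 1) + x n)) :
    ∃ φ : ℝ, φ ∈ Set.Icc (0 : ℝ) 1 ∧
      Filter.Tendsto (fun n : ℕ => x (2 * n)) Filter.atTop (nhds φ) ∧
      Filter.Tendsto (fun n : ℕ => x (2 * n + 1)) Filter.atTop (nhds (1 - φ)) := by
  have hpos3 : ∀ n, 0 < x n ∧ 0 < x (n + 1) ∧ 0 < x (n + 2) := by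
    intro n
    induction n with
    | zero => exact ⟨h0, h1, h2⟩
    | succ k ih =>
      obtain ⟨a, b, c⟩ := ih
      refine ⟨b, c, ?_⟩
      have := hrec k
      rw [show k + 1 + 2 = k + 3 from rfl, this]
      positivity
  have hpos : ∀ n, 0 < x n := fun n => (hpos3 n).1
  have hr : ∀ n, x (n + 3) * (x (n + 1) + x n) = x (n + 1) := by
    intro n
    have h1 := hpos n
    have h2 := hpos (n + 1)
    rw [hrec n]
    field_simp
  have hlt : ∀ n, x (n + 3) < 1 := by
    intro n
    have h1 := hpos n
    have h2 := hpos (n + 1)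
    rw [hrec n, div_lt_one (by positivity)]
    linarith
  have hid : ∀ n, x (n + 4) + x (n + 5) - 1
      = -(x (n + 4) * x (n + 5)) * (x n + x (n + 1) - 1) := by
    intro n
    have r3 := hr n
    have r4 : x (n + 4) * (x (n + 2) + x (n + 1)) = x (n + 2) := hr (n + 1)
    have r5 : x (n + 5) * (x (n + 3) + x (n + 2)) = x (n + 3) := hr (n + 2)
    have hne : x (n + 3) + x (n + 2) ≠ 0 := by
      have h1 := hpos (n + 2)
      have h2 := hpos (n + 3)
      positivity
    apply mul_left_cancel₀ hne
    linear_combination (1 + x (n + 4) * (x n + x (n + 1) - 1)) * r5 + x (n + 4) * r3 + r4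
  obtain ⟨u, hu⟩ : ∃ u : ℕ → ℝ, ∀ n, u n = |x (n + 3) + x (n + 4) - 1| := ⟨_, fun _ => rfl⟩
  have hu0 : ∀ n, 0 ≤ u n := fun n => by rw [hu]; exact abs_nonneg _
  have hu1 : ∀ n, u n < 1 := by
    intro n
    rw [hu, abs_lt]
    have a := hpos (n + 3)
    have b := hpos (n + 4)
    have c := hlt n
    have d : x (n + 4) < 1 := hlt (n + 1)
    constructor <;> linarith
  have hstep : ∀ n, u (n + 4) = x (n + 7) * x (n + 8) * u n := by
    intro n
    have a := hpos (n + 7)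
    have b := hpos (n + 8)
    have e : x (n + 7) + x (n + 8) - 1
      = -(x (n + 7) * x (n + 8)) * (x (n + 3) + x (n + 4) - 1) := hid (n + 3)
    rw [hu, hu]
    change |x (n + 7) + x (n + 8) - 1| = _
    rw [e, abs_mul, abs_neg, abs_of_pos (mul_pos a b)]
  have hdec : ∀ n, u (n + 4) ≤ u n := by
    intro n
    rw [hstep]
    have a := hpos (n + 7)
    have b := hpos (n + 8)
    have c : x (n + 7) < 1 := hlt (n + 4)
    have d : x (n + 8) < 1 := hlt (n + 5)
    have : x (n + 7) * x (n + 8) ≤ 1 := by nlinarith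
    nlinarith [hu0 n]
  obtain ⟨D, hD1, hD⟩ : ∃ D : ℝ, D < 1 ∧ ∀ n, u n ≤ D := by
    refine ⟨max (max (u 0) (u 1)) (max (u 2) (u 3)), ?_, ?_⟩
    · simp [hu1]
    · intro n
      induction n using Nat.strong_induction_on with
      | _ n ih =>
        match n, ih with
        | 0, _ => simp
        | 1, _ => simp
        | 2, _ => simp
        | 3, _ => simp
        | k + 4, ih => exact (hdec k).trans (ih k (by omega))
  have hD0 : 0 ≤ D := (hu0 0).trans (hD 0)
  obtain ⟨q, hq⟩ : ∃ q : ℝ, q = (1 + D) ^ 2 / 4 := ⟨_, rfl⟩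
  have hq1 : q < 1 := by nlinarith
  have hcontr : ∀ n, u (n + 4) ≤ q * u n := by
    intro n
    rw [hstep]
    apply mul_le_mul_of_nonneg_right _ (hu0 n)
    have a := hpos (n + 7)
    have b := hpos (n + 8)
    have c := hD (n + 4)
    rw [hu, abs_le] at c
    have c2 : x (n + 7) + x (n + 8) - 1 ≤ D := c.2
    rw [hq]
    nlinarith [sq_nonneg (x (n + 7) - x (n + 8))]
  have hsum : Summable u := by
    apply summable_of_sum_range_le (c := (∑ i ∈ Finset.range 4, u i) / (1 - q)) hu0
    intro N
    rw [le_div_iff₀ (by linarith)]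
    have e1 : ∑ i ∈ Finset.range N, u i ≤ ∑ i ∈ Finset.range (4 + N), u i :=
      Finset.sum_le_sum_of_subset_of_nonneg
        (Finset.range_mono (by omega)) (fun i _ _ => hu0 i)
    rw [Finset.sum_range_add] at e1
    have e2 : ∑ i ∈ Finset.range N, u (4 + i) ≤ q * ∑ i ∈ Finset.range N, u i := by
      rw [Finset.mul_sum]
      apply Finset.sum_le_sum
      intro i _
      rw [add_comm]
      exact hcontr i
    linarith
  have hdist : ∀ n, dist (x (n + 4)) (x (n + 6)) ≤ u n := by
    intro n
    have r : x (n + 6) * (x (n + 4) + x (n + 3)) = x (n + 4) := hr (n + 3)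
    have a := hpos (n + 6)
    have c : x (n + 6) < 1 := hlt (n + 3)
    have e : x (n + 4) - x (n + 6) = x (n + 6) * (x (n + 3) + x (n + 4) - 1) := by
      linear_combination -r
    rw [Real.dist_eq, e, abs_mul, abs_of_pos a, ← hu]
    nlinarith [hu0 n]
  have hce : CauchySeq (fun n => x (2 * n + 4)) := by
    apply cauchySeq_of_summable_dist
    refine Summable.of_nonneg_of_le (fun _ => dist_nonneg) (fun n => hdist (2 * n)) ?_
    exact hsum.comp_injective (i := fun n => 2 * n) (fun a b h => by simpa using h)
  have hco : CauchySeq (fun n => x (2 * n + 5)) := by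
    apply cauchySeq_of_summable_dist
    refine Summable.of_nonneg_of_le (fun _ => dist_nonneg) (fun n => hdist (2 * n + 1)) ?_
    exact hsum.comp_injective (i := fun n => 2 * n + 1) (fun a b h => by simpa using h)
  obtain ⟨φ, hφ⟩ := cauchySeq_tendsto_of_complete hce
  obtain ⟨ψ, hψ⟩ := cauchySeq_tendsto_of_complete hco
  have hs : φ + ψ - 1 = 0 := by
    have t1 : Filter.Tendsto (fun n => |x (2 * n + 4) + x (2 * n + 5) - 1|) Filter.atTop
        (nhds |φ + ψ - 1|) := ((hφ.add hψ).sub_const 1).abs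
    have t2 : Filter.Tendsto (fun n => u (2 * n + 1)) Filter.atTop (nhds 0) :=
      (hsum.comp_injective (i := fun n => 2 * n + 1)
        (fun a b h => by simpa using h)).tendsto_atTop_zero
    have t3 : (fun n => u (2 * n + 1)) = fun n => |x (2 * n + 4) + x (2 * n + 5) - 1| := by
      funext n
      exact hu (2 * n + 1)
    rw [t3] at t2
    exact abs_eq_zero.mp (tendsto_nhds_unique t1 t2)
  refine ⟨φ, ⟨?_, ?_⟩, ?_, ?_⟩
  · exact ge_of_tendsto' hφ (fun n => (hpos _).le)
  · exact le_of_tendsto' hφ (fun n => (hlt (2 * n + 1)).le)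
  · rw [← Filter.tendsto_add_atTop_iff_nat 2]
    exact hφ
  · rw [← Filter.tendsto_add_atTop_iff_nat 2, show 1 - φ = ψ by linarith]
    exact hψ
end

section
/- Let x : ℕ → ℝ be a sequence with x₀ > 0, x₁ > 0, x₂ > 0 and satisfying x_{n+3} = (x_{n+2} + x_n)/x_{n+1} for all n ≥ 0. Then for each j ∈ {0,1,2,3} the subsequence x_{4n+j} converges to a positive limit L_j, and moreover L₀·L₁ > 1, L₂ = (L₀ + L₁²)/(L₀L₁ − 1), and L₃ = (L₀² + L₁)/(L₀L₁ − 1). -/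
open Filter Topology

/-- The (sign-changed) semi-invariant. -/
def alJ (x : ℕ → ℝ) (n : ℕ) : ℝ :=
  x n + x (n + 2) + x (n + 1) ^ 2 - x n * x (n + 1) * x (n + 2)

theorem al_pos (x : ℕ → ℝ)
    (h0 : x 0 > 0) (h1 : x 1 > 0) (h2 : x 2 > 0)
    (hrec : ∀ n : ℕ, x (n + 3) = (x (n + 2) + x n) / x (n + 1)) (n : ℕ) : 0 < x n := by
  have : 0 < x n ∧ 0 < x (n + 1) ∧ 0 < x (n + 2) := by
    induction n with
    | zero => exact ⟨h0, h1, h2⟩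
    | succ k ih =>
      obtain ⟨a, b, c⟩ := ih
      refine ⟨b, c, ?_⟩
      have := hrec k
      rw [show k + 1 + 2 = k + 3 from rfl, this]
      positivity
  exact this.1

theorem al_mul (x : ℕ → ℝ) (hp : ∀ n, 0 < x n)
    (hrec : ∀ n : ℕ, x (n + 3) = (x (n + 2) + x n) / x (n + 1)) (n : ℕ) :
    x (n + 1) * x (n + 3) = x n + x (n + 2) := by
  have := (hp (n + 1)).ne'
  rw [hrec n]; field_simp; ring

theorem al_J (x : ℕ → ℝ) (hp : ∀ n, 0 < x n)
    (hrec : ∀ n : ℕ, x (n + 3) = (x (n + 2) + x n) / x (n + 1)) (n : ℕ) :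
    alJ x (n + 1) * x (n + 1) = alJ x n := by
  have h := al_mul x hp hrec n
  simp only [alJ, add_assoc, Nat.reduceAdd]
  linear_combination (1 - x (n + 1) * x (n + 2)) * h

theorem al_inc (x : ℕ → ℝ) (hp : ∀ n, 0 < x n)
    (hrec : ∀ n : ℕ, x (n + 3) = (x (n + 2) + x n) / x (n + 1)) (n : ℕ) :
    (x (n + 4) - x n) * (x (n + 1) * x (n + 2)) = alJ x n := by
  have h := al_mul x hp hrec n
  have h' := al_mul x hp hrec (n + 1)
  simp only [add_assoc, Nat.reduceAdd] at h'
  simp only [alJ]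
  linear_combination h + x (n + 1) * h'

theorem al_J_nonneg (x : ℕ → ℝ) (hp : ∀ n, 0 < x n)
    (hrec : ∀ n : ℕ, x (n + 3) = (x (n + 2) + x n) / x (n + 1)) (h : 0 ≤ alJ x 0) (n : ℕ) :
    0 ≤ alJ x n := by
  induction n with
  | zero => exact h
  | succ k ih =>
    rw [← al_J x hp hrec k] at ih
    exact nonneg_of_mul_nonneg_left ih (hp _)

theorem al_J_neg (x : ℕ → ℝ) (hp : ∀ n, 0 < x n)
    (hrec : ∀ n : ℕ, x (n + 3) = (x (n + 2) + x n) / x (n + 1)) (h : alJ x 0 < 0) (n : ℕ) :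
    alJ x n < 0 := by
  induction n with
  | zero => exact h
  | succ k ih =>
    rw [← al_J x hp hrec k] at ih
    exact (neg_iff_pos_of_mul_neg ih).2 (hp _)

theorem al_step (x : ℕ → ℝ) (hp : ∀ n, 0 < x n)
    (hrec : ∀ n : ℕ, x (n + 3) = (x (n + 2) + x n) / x (n + 1)) (h : 0 ≤ alJ x 0) (n : ℕ) :
    x n ≤ x (n + 4) := by
  have h1 := al_J_nonneg x hp hrec h n
  rw [← al_inc x hp hrec n] at h1
  have := nonneg_of_mul_nonneg_left h1 (mul_pos (hp _) (hp _))
  linarith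

theorem al_mono (x : ℕ → ℝ) (hs : ∀ n, x n ≤ x (n + 4)) (j : ℕ) :
    Monotone (fun n : ℕ => x (4 * n + j)) := by
  apply monotone_nat_of_le_succ
  intro n
  have := hs (4 * n + j)
  rwa [show 4 * n + j + 4 = 4 * (n + 1) + j by ring] at this

theorem al_bdd (x : ℕ → ℝ) (hp : ∀ n, 0 < x n)
    (hrec : ∀ n : ℕ, x (n + 3) = (x (n + 2) + x n) / x (n + 1)) (h : 0 ≤ alJ x 0) :
    ∃ C, ∀ n, x (4 * n) ≤ C := by
  by_contra! hc
  have hs := al_step x hp hrec h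
  have hm := al_mono x hs
  have hlow : ∀ j n, x j ≤ x (4 * n + j) := fun j n => by
    simpa using hm j (Nat.zero_le n)
  obtain ⟨N, hN⟩ := hc (2 / (x 1 * x 2 * x 3))
  have hq : 0 < x 1 * x 2 * x 3 := by have := hp 1; have := hp 2; have := hp 3; positivity
  rw [div_lt_iff₀ hq] at hN
  have hB : 0 < x 1 * x 2 := mul_pos (hp 1) (hp 2)
  have key : ∀ n, N ≤ n → x (4 * (n + 1)) * (x 1 * x 2) + 2 * alJ x (4 * (n + 1))
      ≤ x (4 * n) * (x 1 * x 2) + 2 * alJ x (4 * n) := by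
    intro n hn
    have e0 := al_J x hp hrec (4 * n)
    have e1 := al_J x hp hrec (4 * n + 1)
    have e2 := al_J x hp hrec (4 * n + 2)
    have e3 := al_J x hp hrec (4 * n + 3)
    have ei := al_inc x hp hrec (4 * n)
    simp only [add_assoc, Nat.reduceAdd] at e0 e1 e2 e3
    have hJ4 := al_J_nonneg x hp hrec h (4 * n + 4)
    have l1 := hlow 1 n
    have l2 := hlow 2 n
    have l3 := hlow 3 n
    have l4 : x (4 * N) ≤ x (4 * n + 4) := by
      have := hm 0 (show N ≤ n + 1 by omega)
      simpa [mul_add] using this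
    have p1 := hp 1
    have p2 := hp 2
    have p3 := hp 3
    have p4 := hp (4 * N)
    have hprod : x 1 * x 2 * x 3 * x (4 * N) ≤
        x (4 * n + 1) * x (4 * n + 2) * x (4 * n + 3) * x (4 * n + 4) := by
      have := hp (4 * n + 1)
      have := hp (4 * n + 2)
      have := hp (4 * n + 3)
      gcongr
    have hJ : 2 * alJ x (4 * n + 4) ≤ alJ x (4 * n) := by
      have : alJ x (4 * n) = alJ x (4 * n + 4) *
          (x (4 * n + 1) * x (4 * n + 2) * x (4 * n + 3) * x (4 * n + 4)) := by
        rw [← e0, ← e1, ← e2, ← e3]; ring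
      rw [this]
      nlinarith
    have hprod2 : x 1 * x 2 ≤ x (4 * n + 1) * x (4 * n + 2) := by
      have := hp (4 * n + 1)
      gcongr
    have hi : 0 ≤ x (4 * n + 4) - x (4 * n) := sub_nonneg.2 (hs _)
    have := mul_le_mul_of_nonneg_left hprod2 hi
    rw [show 4 * (n + 1) = 4 * n + 4 by ring]
    linarith
  set V := x (4 * N) * (x 1 * x 2) + 2 * alJ x (4 * N) with hV
  have hall : ∀ n, N ≤ n → x (4 * n) * (x 1 * x 2) + 2 * alJ x (4 * n) ≤ V := by
    intro n hn
    induction n, hn using Nat.le_induction with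
    | base => exact le_rfl
    | succ k hk ih => exact (key k hk).trans ih
  obtain ⟨m, hm'⟩ := hc (V / (x 1 * x 2))
  rw [div_lt_iff₀ hB] at hm'
  have a1 := hall (max N m) (le_max_left _ _)
  have a2 : x (4 * m) ≤ x (4 * max N m) := by simpa using hm 0 (le_max_right N m)
  have a3 := al_J_nonneg x hp hrec h (4 * max N m)
  nlinarith

theorem al_conv (x : ℕ → ℝ) (hp : ∀ n, 0 < x n)
    (hrec : ∀ n : ℕ, x (n + 3) = (x (n + 2) + x n) / x (n + 1)) :
    ∃ l, 0 ≤ l ∧ Tendsto (fun n : ℕ => x (4 * n)) atTop (𝓝 l) := by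
  have hl : ∀ l, Tendsto (fun n : ℕ => x (4 * n)) atTop (𝓝 l) → 0 ≤ l := fun l hl =>
    ge_of_tendsto' hl fun n => (hp _).le
  by_cases h : 0 ≤ alJ x 0
  · obtain ⟨C, hC⟩ := al_bdd x hp hrec h
    have hm := al_mono x (al_step x hp hrec h) 0
    have := tendsto_atTop_ciSup hm ⟨C, by rintro _ ⟨n, rfl⟩; exact hC n⟩
    exact ⟨_, hl _ this, this⟩
  · have hm : Antitone (fun n : ℕ => x (4 * n)) := by
      apply antitone_nat_of_succ_le
      intro n
      have h1 := al_J_neg x hp hrec (not_le.1 h) (4 * n)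
      rw [← al_inc x hp hrec (4 * n)] at h1
      have := (neg_iff_pos_of_mul_neg h1).2 (mul_pos (hp _) (hp _))
      rw [show 4 * (n + 1) = 4 * n + 4 by ring]
      linarith
    have := tendsto_atTop_ciInf hm ⟨0, by rintro _ ⟨n, rfl⟩; exact (hp _).le⟩
    exact ⟨_, hl _ this, this⟩

theorem al_low (x : ℕ → ℝ) (hp : ∀ n, 0 < x n)
    (hrec : ∀ n : ℕ, x (n + 3) = (x (n + 2) + x n) / x (n + 1)) :
    ∃ e, 0 < e ∧ ∀ n, e ≤ x (4 * n) + x (4 * n + 2) := by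
  by_cases h : 0 ≤ alJ x 0
  · refine ⟨x 0, hp 0, fun n => ?_⟩
    have := al_mono x (al_step x hp hrec h) 0 (Nat.zero_le n)
    have h2 := hp (4 * n + 2)
    simp at this
    linarith
  · refine ⟨1, one_pos, fun n => ?_⟩
    have h1 := al_J_neg x hp hrec (not_le.1 h) (4 * n)
    have a := hp (4 * n)
    have b := hp (4 * n + 1)
    have c := hp (4 * n + 2)
    simp only [alJ] at h1
    generalize x (4 * n) = A at *
    generalize x (4 * n + 1) = B at *
    generalize x (4 * n + 2) = C at *
    by_contra! hlt
    have k1 : A * C ≤ (A + C) / 4 := by nlinarith [sq_nonneg (A - C)]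
    have k2 : B * (A * C) ≤ B * ((A + C) / 4) := mul_le_mul_of_nonneg_left k1 b.le
    nlinarith [sq_nonneg (B - (A + C) / 8)]

/-- Amleh–Ladas Conjecture 2: every positive solution of
`x_{n+3} = (x_{n+2}+x_n)/x_{n+1}` converges to a period-four solution
`…, φ, ψ, (φ+ψ²)/(φψ-1), (φ²+ψ)/(φψ-1), …` with `φψ > 1`. -/
theorem amleh_ladas_conj2 (x : ℕ → ℝ)
    (h0 : x 0 > 0) (h1 : x 1 > 0) (h2 : x 2 > 0)
    (hrec : ∀ n : ℕ, x (n + 3) = (x (n + 2) + x n) / x (n + 1)) :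
    ∃ L : Fin 4 → ℝ, (∀ j, 0 < L j) ∧
      (∀ j : Fin 4, Filter.Tendsto (fun n : ℕ => x (4 * n + (j : ℕ)))
        Filter.atTop (nhds (L j))) ∧
      L 0 * L 1 > 1 ∧
      L 2 = (L 0 + (L 1) ^ 2) / (L 0 * L 1 - 1) ∧
      L 3 = ((L 0) ^ 2 + L 1) / (L 0 * L 1 - 1) := by
  have hp := al_pos x h0 h1 h2 hrec
  have hc : ∀ j, ∃ l, 0 ≤ l ∧ Tendsto (fun n : ℕ => x (4 * n + j)) atTop (𝓝 l) := fun j =>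
    al_conv (fun n => x (n + j)) (fun n => hp _) (fun n => by
      have := hrec (n + j)
      simp only [show n + 3 + j = n + j + 3 by ring, show n + 2 + j = n + j + 2 by ring,
        show n + 1 + j = n + j + 1 by ring]
      exact this)
  obtain ⟨a, ha, ta⟩ := hc 0
  obtain ⟨b, hb, tb⟩ := hc 1
  obtain ⟨c, hcc, tc⟩ := hc 2
  obtain ⟨d, hd, td⟩ := hc 3
  have ta' : Tendsto (fun n : ℕ => x (4 * n + 4)) atTop (𝓝 a) :=
    ta.comp (tendsto_add_atTop_nat 1)
  simp only [add_zero] at ta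
  have e1 : b * d = a + c := tendsto_nhds_unique (tb.mul td)
    ((ta.add tc).congr fun n => (al_mul x hp hrec (4 * n)).symm)
  have e2 : c * a = b + d := tendsto_nhds_unique (tc.mul ta')
    ((tb.add td).congr fun n => (al_mul x hp hrec (4 * n + 1)).symm)
  have e3 : (a - a) * (b * c) = a + c + b ^ 2 - a * b * c :=
    tendsto_nhds_unique ((ta'.sub ta).mul (tb.mul tc))
    ((((ta.add tc).add (tb.pow 2)).sub ((ta.mul tb).mul tc)).congr
      fun n => (al_inc x hp hrec (4 * n)).symm)
  obtain ⟨e, he, hlow⟩ := al_low x hp hrec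
  have hac : 0 < a + c := lt_of_lt_of_le he (ge_of_tendsto' (ta.add tc) hlow)
  have hb' : 0 < b := by
    rcases hb.eq_or_lt with h | h
    · rw [← h] at e1; linarith
    · exact h
  have hd' : 0 < d := by
    rcases hd.eq_or_lt with h | h
    · rw [← h] at e1; linarith
    · exact h
  have ha' : 0 < a := by
    rcases ha.eq_or_lt with h | h
    · rw [← h] at e2; linarith
    · exact h
  have hc' : 0 < c := by
    rcases hcc.eq_or_lt with h | h
    · rw [← h] at e2; linarith
    · exact h
  have e4 : c * (a * b - 1) = a + b ^ 2 := by linarith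
  have hab : 0 < a * b - 1 := by
    have : 0 < c * (a * b - 1) := by rw [e4]; positivity
    exact pos_of_mul_pos_right this hc'.le
  refine ⟨![a, b, c, d], ?_, ?_, ?_, ?_, ?_⟩
  · intro j; fin_cases j <;> simpa
  · intro j; fin_cases j
    · exact ta
    · exact tb
    · exact tc
    · exact td
  · show a * b > 1
    linarith
  · show c = (a + b ^ 2) / (a * b - 1)
    rw [eq_div_iff hab.ne']; exact e4
  · show d = (a ^ 2 + b) / (a * b - 1)
    rw [eq_div_iff hab.ne']
    linear_combination a * e1 + e2
end

section
/- Let x : ℕ → ℝ be a sequence with x₀ > 0, x₁ > 0, x₂ > 0 and satisfying x_{n+3} = (1 + x_n)/x_{n+2} for all n ≥ 0. Then for each j ∈ {0,1,2,3,4} the subsequence x_{5n+j} converges to a positive limit L_j, and moreover L₀·L₁ > 1, L₂ = (1 + L₀)/(L₀L₁ − 1), L₃ = L₀L₁ − 1, and L₄ = (1 + L₁)/(L₀L₁ − 1). -/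
/-- Amleh–Ladas Conjecture 3: every positive solution of
`x_{n+3} = (1+x_n)/x_{n+2}` converges to a period-five solution
`…, φ, ψ, (1+φ)/(φψ-1), φψ-1, (1+ψ)/(φψ-1), …` with `φψ > 1`. -/
theorem amleh_ladas_conj3 (x : ℕ → ℝ)
    (h0 : x 0 > 0) (h1 : x 1 > 0) (h2 : x 2 > 0)
    (hrec : ∀ n : ℕ, x (n + 3) = (1 + x n) / x (n + 2)) :
    ∃ L : Fin 5 → ℝ, (∀ j, 0 < L j) ∧
      (∀ j : Fin 5, Filter.Tendsto (fun n : ℕ => x (5 * n + (j : ℕ)))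
        Filter.atTop (nhds (L j))) ∧
      L 0 * L 1 > 1 ∧
      L 2 = (1 + L 0) / (L 0 * L 1 - 1) ∧
      L 3 = L 0 * L 1 - 1 ∧
      L 4 = (1 + L 1) / (L 0 * L 1 - 1) := by
  have hpos3 : ∀ n, 0 < x n ∧ 0 < x (n + 1) ∧ 0 < x (n + 2) := by
    intro n
    induction n with
    | zero => exact ⟨h0, h1, h2⟩
    | succ k ih =>
      obtain ⟨a, b, c⟩ := ih
      refine ⟨b, c, ?_⟩
      show 0 < x (k + 3)
      rw [hrec k]
      positivity
  have hpos : ∀ n, 0 < x n := fun n => (hpos3 n).1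
  have hmul : ∀ n, x (n + 2) * x (n + 3) = 1 + x n := by
    intro n
    rw [hrec n]
    have := (hpos (n + 2)).ne'
    field_simp
  -- the defect from being 5-periodic
  obtain ⟨E, hE⟩ : ∃ E : ℕ → ℝ, ∀ n, E n = 1 + x n + x (n + 2) - x n * x (n + 1) * x (n + 2) :=
    ⟨_, fun _ => rfl⟩
  have hE1 : ∀ n, E (n + 1) = 1 + x (n + 3) - x n * x (n + 1) := by
    intro n
    have h := hE (n + 1)
    have e := hmul n
    simp only [add_assoc, Nat.reduceAdd] at h
    rw [h]
    linear_combination (-x (n + 1)) * e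
  have hEs : ∀ n, E n = x (n + 2) * E (n + 1) := by
    intro n
    rw [hE1, hE]
    linear_combination (-1) * hmul n
  have hE2 : ∀ n, E n = (1 + x n) * E (n + 2) := by
    intro n
    rw [hEs n, hEs (n + 1), ← hmul n]
    simp only [add_assoc, Nat.reduceAdd]
    ring
  have hstep : ∀ n, x (n + 5) = x n + E (n + 3) := by
    intro n
    have a := hE1 n
    have b := hE2 (n + 1)
    have c := hmul (n + 1)
    have d := hmul (n + 2)
    simp only [add_assoc, Nat.reduceAdd] at a b c d
    have p1 := hpos (n + 1)
    have p3 := hpos (n + 3)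
    have p4 := hpos (n + 4)
    have hne : (1 + x (n + 1)) ≠ 0 := by positivity
    apply mul_left_cancel₀ hne
    linear_combination b - a - x (n + 5) * c + x (n + 3) * d + hmul n
  -- convergence of each subsequence
  have hconv : ∀ j : ℕ, ∃ l, Filter.Tendsto (fun n : ℕ => x (5 * n + j)) Filter.atTop (nhds l) := by
    intro j
    rcases le_total (E 0) 0 with hneg | hnn
    · have hEn : ∀ n, E n ≤ 0 := by
        intro n
        induction n with
        | zero => exact hneg
        | succ k ih =>
          rw [hEs k] at ih
          have := hpos (k + 2)
          by_contra! hc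
          nlinarith [mul_pos this hc]
      refine ⟨_, tendsto_atTop_ciInf (antitone_nat_of_succ_le ?_) ⟨0, ?_⟩⟩
      · intro n
        have h := hstep (5 * n + j)
        have h' := hEn (5 * n + j + 3)
        have e : 5 * (n + 1) + j = 5 * n + j + 5 := by ring
        rw [e]
        linarith
      · rintro _ ⟨n, rfl⟩
        exact (hpos _).le
    · have hEn : ∀ n, 0 ≤ E n := by
        intro n
        induction n with
        | zero => exact hnn
        | succ k ih =>
          rw [hEs k] at ih
          exact nonneg_of_mul_nonneg_right ih (hpos (k + 2))
      obtain ⟨m, hm, hm0, hm1, hm2, hm3, hm4⟩ : ∃ m, 0 < m ∧ m ≤ x 0 ∧ m ≤ x 1 ∧ m ≤ x 2 ∧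
          m ≤ x 3 ∧ m ≤ x 4 := by
        refine ⟨min (x 0) (min (x 1) (min (x 2) (min (x 3) (x 4)))), ?_, ?_⟩
        · simp [hpos]
        · simp
      have hlow : ∀ n, m ≤ x n := by
        intro n
        induction n using Nat.strong_induction_on with
        | _ n ih =>
          match n, ih with
          | 0, _ => exact hm0
          | 1, _ => exact hm1
          | 2, _ => exact hm2
          | 3, _ => exact hm3
          | 4, _ => exact hm4
          | k + 5, ih =>
            have := ih k (by omega)
            rw [hstep k]
            linarith [hEn (k + 3)]
      have hdec : ∀ n, m * (x n + x (n + 1) + x (n + 2) + x (n + 3) + x (n + 4))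
          + (E (n + 1) + E (n + 2)) ≤
          m * (x 0 + x 1 + x 2 + x 3 + x 4) + (E 1 + E 2) := by
        intro n
        induction n with
        | zero => simp
        | succ k ih =>
          refine le_trans ?_ ih
          have b := hE2 (k + 1)
          have s := hstep k
          have hl := mul_le_mul_of_nonneg_right (hlow (k + 1)) (hEn (k + 3))
          simp only [add_assoc, Nat.reduceAdd] at b s ⊢
          rw [s, b]
          nlinarith
      refine ⟨_, tendsto_atTop_ciSup (monotone_nat_of_le_succ ?_)
        ⟨(m * (x 0 + x 1 + x 2 + x 3 + x 4) + (E 1 + E 2)) / m, ?_⟩⟩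
      · intro n
        have h := hstep (5 * n + j)
        have h' := hEn (5 * n + j + 3)
        have e : 5 * (n + 1) + j = 5 * n + j + 5 := by ring
        rw [e]
        linarith
      · rintro _ ⟨n, rfl⟩
        show x (5 * n + j) ≤ _
        rw [le_div_iff₀ hm]
        generalize 5 * n + j = k
        have p := mul_pos hm (hpos (k + 1))
        have q := mul_pos hm (hpos (k + 2))
        have r := mul_pos hm (hpos (k + 3))
        have s := mul_pos hm (hpos (k + 4))
        linarith [hdec k, hEn (k + 1), hEn (k + 2)]
  choose l hl using hconv
  have hl5 : ∀ j, l (j + 5) = l j := by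
    intro j
    refine tendsto_nhds_unique (hl (j + 5)) ?_
    have h := (hl j).comp (Filter.tendsto_add_atTop_nat 1)
    refine h.congr fun n => ?_
    show x (5 * (n + 1) + j) = x (5 * n + (j + 5))
    congr 1
    ring
  have hlnn : ∀ j, 0 ≤ l j := fun j => ge_of_tendsto' (hl j) fun n => (hpos _).le
  have hlm : ∀ j, l (j + 2) * l (j + 3) = 1 + l j := by
    intro j
    refine tendsto_nhds_unique ((hl (j + 2)).mul (hl (j + 3))) ?_
    refine ((hl j).const_add 1).congr fun n => ?_
    exact (hmul (5 * n + j)).symm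
  have hlpos : ∀ j, 0 < l j := by
    intro j
    refine lt_of_le_of_ne (hlnn j) fun h => ?_
    have a := hlm (j + 3)
    have b := hlnn (j + 3)
    have c := hl5 j
    simp only [add_assoc, Nat.reduceAdd] at a
    rw [c, ← h] at a
    linarith
  have e3 : l 0 * l 1 = 1 + l 3 := by
    have := hlm 3
    have a := hl5 0
    have b := hl5 1
    simp only [Nat.reduceAdd] at this a b
    rwa [a, b] at this
  have e0 : l 2 * l 3 = 1 + l 0 := hlm 0
  have e1 : l 3 * l 4 = 1 + l 1 := hlm 1
  have p3 := hlpos 3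
  have k3 : l 0 * l 1 - 1 = l 3 := by linarith
  refine ⟨fun j => l j, fun j => hlpos j, fun j => hl j, ?_, ?_, ?_, ?_⟩
  · show l 0 * l 1 > 1
    linarith
  · show l 2 = (1 + l 0) / (l 0 * l 1 - 1)
    rw [k3, eq_div_iff p3.ne', e0]
  · exact k3.symm
  · show l 4 = (1 + l 1) / (l 0 * l 1 - 1)
    rw [k3, eq_div_iff p3.ne', ← e1]
    ring
end

section
/- Define T : {(x,y,z) ∈ ℝ³ : x>0, y>0, z>0} → ℝ³ by T(x,y,z) = (y, z, y/(x+y)), and note that T maps the open positive octant into itself, so the fourth iterate T⁴ is defined there. Define v_{xy}(x,y,z) = (x + y − 1)². Then for all x, y, z > 0, writing (a,b,c) = T⁴(x,y,z), one has (a + b − 1)² ≤ (x + y − 1)², i.e. v_{xy}(T⁴(x,y,z)) ≤ v_{xy}(x,y,z). -/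
/-- The map encoding the Amleh–Ladas equation `x_{n+1} = x_{n-1}/(x_{n-1}+x_{n-2})`
as a dynamical system on the positive octant: `T(x,y,z) = (y, z, y/(x+y))`. -/
noncomputable def T : ℝ × ℝ × ℝ → ℝ × ℝ × ℝ :=
  fun p => (p.2.1, p.2.2, p.2.1 / (p.1 + p.2.1))

/-- The quantity `v_{xy}(x,y,z) = (x+y-1)²` is nonincreasing under four
applications of `T` on the positive octant. -/
theorem vxy_decreasing (x y z : ℝ) (hx : 0 < x) (hy : 0 < y) (hz : 0 < z) :
    ((T^[4] (x, y, z)).1 + (T^[4] (x, y, z)).2.1 - 1) ^ 2 ≤ (x + y - 1) ^ 2 := by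
  have hxy : x + y ≠ 0 := by positivity
  have hyz : y + z ≠ 0 := by positivity
  have hD : x * z + y * z + y ≠ 0 := by positivity
  have hw : z + y / (x + y) ≠ 0 := by positivity
  have key : (T^[4] (x, y, z)).1 + (T^[4] (x, y, z)).2.1 - 1
      = (y * z / ((x * z + y * z + y) * (y + z))) * (1 - x - y) := by
    have h3 : y / (x + y) / (z + y / (x + y)) = y / (x * z + y * z + y) := by
      rw [div_eq_div_iff hw hD]
      field_simp
    simp only [T, Function.iterate_succ, Function.iterate_zero, Function.comp, id]
    rw [h3]
    field_simp
    ring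
  have h0 : 0 ≤ y * z / ((x * z + y * z + y) * (y + z)) := by positivity
  have h1 : y * z / ((x * z + y * z + y) * (y + z)) ≤ 1 := by
    rw [div_le_one (by positivity)]
    have : (x * z + y * z + y) * (y + z)
        = y * z + ((x * z + y * z) * (y + z) + y * y) := by ring
    rw [this]
    have : 0 ≤ (x * z + y * z) * (y + z) + y * y := by positivity
    linarith
  rw [key, mul_pow]
  have h2 := pow_le_one₀ (n := 2) h0 h1
  have h4 := mul_le_mul_of_nonneg_right h2 (sq_nonneg (1 - x - y))
  have h5 : (x + y - 1) ^ 2 = 1 * (1 - x - y) ^ 2 := by ring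
  rw [h5]
  exact h4
end

section
/- Define T : {(x,y,z) ∈ ℝ³ : x>0, y>0, z>0} → ℝ³ by T(x,y,z) = (y, z, y/(x+y)), and note that T maps the open positive octant into itself, so the fourth iterate T⁴ is defined there. Define v_{yz}(x,y,z) = (y + z − 1)². Then for all x, y, z > 0, writing (a,b,c) = T⁴(x,y,z), one has (b + c − 1)² ≤ (y + z − 1)², i.e. v_{yz}(T⁴(x,y,z)) ≤ v_{yz}(x,y,z). -/
/-- The quantity `v_{yz}(x,y,z) = (y+z-1)²` is nonincreasing under four
applications of `T` on the positive octant. -/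
theorem vyz_decreasing (x y z : ℝ) (hx : 0 < x) (hy : 0 < y) (hz : 0 < z) :
    ((T^[4] (x, y, z)).2.1 + (T^[4] (x, y, z)).2.2 - 1) ^ 2 ≤ (y + z - 1) ^ 2 := by
  have hw : 0 < y / (x + y) := by positivity
  have e : ∀ w : ℝ, 0 < w → w / (z + w) + (z / (y + z)) / (w + z / (y + z)) - 1
      = (w * z / ((z + w) * (w * (y + z) + z))) * (-(y + z - 1)) := by
    intro w hw
    have h1 : y + z ≠ 0 := by positivity
    have h2 : z + w ≠ 0 := by positivity
    have h3 : w * (y + z) + z ≠ 0 := by positivity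
    have h4 : (z / (y + z)) / (w + z / (y + z)) = z / (w * (y + z) + z) := by
      have h5 : w + z / (y + z) = (w * (y + z) + z) / (y + z) := by
        field_simp
      rw [h5, div_div_div_cancel_right₀ h1]
    rw [h4]
    field_simp
    ring
  have e2 : (T^[4] (x, y, z)).2.1 + (T^[4] (x, y, z)).2.2 - 1
      = y / (x + y) / (z + y / (x + y))
        + (z / (y + z)) / (y / (x + y) + z / (y + z)) - 1 := rfl
  rw [e2, e _ hw]
  generalize y / (x + y) = w at hw
  have k0 : 0 ≤ w * z / ((z + w) * (w * (y + z) + z)) := by positivity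
  have k1 : w * z / ((z + w) * (w * (y + z) + z)) ≤ 1 := by
    rw [div_le_one (by positivity)]
    have : 0 ≤ (z + w) * (w * (y + z)) + z * z := by positivity
    nlinarith
  rw [mul_pow, neg_sq]
  exact mul_le_of_le_one_left (sq_nonneg _) (pow_le_one₀ k0 k1)
end

section
/- Let x : ℕ → ℝ be a sequence with x₀ > 0, x₁ > 0, x₂ > 0 satisfying the third-order difference equation x_{n+3} = (1 + x_{n+2} + x_{n+1})/x_n for all n ≥ 0. Then x is periodic with period 8: x_{n+8} = x_n for all n ≥ 0. -/
/-- Every positive solution of the third-order equation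
`x_{n+3} = (1+x_{n+2}+x_{n+1})/x_n` is periodic of period 8. -/
theorem period_eight (x : ℕ → ℝ) (h0 : x 0 > 0) (h1 : x 1 > 0) (h2 : x 2 > 0)
    (hrec : ∀ n : ℕ, x (n + 3) = (1 + x (n + 2) + x (n + 1)) / x n) :
    ∀ n : ℕ, x (n + 8) = x n := by
  have hpos : ∀ n : ℕ, 0 < x n ∧ 0 < x (n + 1) ∧ 0 < x (n + 2) := by
    intro n
    induction n with
    | zero => exact ⟨h0, h1, h2⟩
    | succ k ih =>
      obtain ⟨p, q, r⟩ := ih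
      refine ⟨q, r, ?_⟩
      have h := hrec k
      have : 0 < x (k + 3) := by rw [h]; positivity
      exact this
  intro n
  obtain ⟨ha, hb, hc⟩ := hpos n
  have e3 := hrec n
  have e4 : x (n + 4) = (1 + x (n + 3) + x (n + 2)) / x (n + 1) := hrec (n + 1)
  have e5 : x (n + 5) = (1 + x (n + 4) + x (n + 3)) / x (n + 2) := hrec (n + 2)
  have e6 : x (n + 6) = (1 + x (n + 5) + x (n + 4)) / x (n + 3) := hrec (n + 3)
  have e7 : x (n + 7) = (1 + x (n + 6) + x (n + 5)) / x (n + 4) := hrec (n + 4)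
  have e8 : x (n + 8) = (1 + x (n + 7) + x (n + 6)) / x (n + 5) := hrec (n + 5)
  generalize x n = a at *
  generalize x (n + 1) = b at *
  generalize x (n + 2) = c at *
  have f4 : x (n + 4) = (a + a * c + 1 + b + c) / (a * b) := by
    rw [e4, e3]; field_simp; ring
  have f5 : x (n + 5) = (1 + a + b) * (1 + b + c) / (a * b * c) := by
    rw [e5, f4, e3]; field_simp; ring
  have f6 : x (n + 6) = (a + a * c + 1 + b + c) / (b * c) := by
    rw [e6, f5, f4, e3]; field_simp; ring
  have f7 : x (n + 7) = (1 + a + b) / c := by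
    have : 0 < a + a * c + 1 + b + c := by positivity
    rw [e7, f6, f5, f4]
    rw [div_eq_div_iff (by positivity) (by positivity)]
    field_simp; ring
  rw [e8, f7, f6, f5]
  rw [div_eq_iff (by positivity)]
  field_simp; ring
end

section
/- Let p > 0 and let x : ℕ → ℝ be a sequence with x₀ > 0, x₁ > 0 satisfying the generalized Lyness equation x_{n+2} = (p + x_{n+1})/x_n for all n ≥ 0. Then the sequence is bounded above and bounded away from zero: there exist real numbers m, M with 0 < m ≤ M such that m ≤ x_n ≤ M for all n ≥ 0. -/
/-- Every positive solution of the generalized Lyness equation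
`x_{n+2} = (p+x_{n+1})/x_n` is bounded above and bounded away from zero. -/
theorem lyness_bounded (p : ℝ) (hp : 0 < p) (x : ℕ → ℝ)
    (h0 : x 0 > 0) (h1 : x 1 > 0)
    (hrec : ∀ n : ℕ, x (n + 2) = (p + x (n + 1)) / x n) :
    ∃ m M : ℝ, 0 < m ∧ m ≤ M ∧ ∀ n : ℕ, m ≤ x n ∧ x n ≤ M := by
  have pos : ∀ n, 0 < x n ∧ 0 < x (n + 1) := by
    intro n
    induction n with
    | zero => exact ⟨h0, h1⟩
    | succ k ih =>
      obtain ⟨ha, hb⟩ := ih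
      refine ⟨hb, ?_⟩
      rw [show k + 1 + 1 = k + 2 from rfl, hrec k]
      positivity
  obtain ⟨I, hI⟩ : ∃ I, I = (p + x 0 + x 1) * (1 + 1 / x 0) * (1 + 1 / x 1) := ⟨_, rfl⟩
  have inv : ∀ n, I = (p + x n + x (n + 1)) * (1 + 1 / x n) * (1 + 1 / x (n + 1)) := by
    intro n
    induction n with
    | zero => exact hI
    | succ k ih =>
      obtain ⟨ha, hb⟩ := pos k
      have hpb : 0 < p + x (k + 1) := by positivity
      rw [ih, show k + 1 + 1 = k + 2 from rfl, hrec k]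
      field_simp
      ring
  have hIpos : 0 < I := by rw [hI]; positivity
  have key : ∀ n, p / I ≤ x n ∧ x n ≤ I := by
    intro n
    obtain ⟨ha, hb⟩ := pos n
    have h := inv n
    have hu : 0 < 1 / x n := by positivity
    have hv : 0 < 1 / x (n + 1) := by positivity
    have e : x n * (1 / x n) = 1 := by field_simp
    have hS : (p + x n + x (n + 1)) * (1 + 1 / x n) ≤ I := by
      rw [h]
      exact le_mul_of_one_le_right (by positivity) (by linarith)
    have h2 : 0 < x (n + 1) * (1 / x n) := by positivity
    have h3 : 0 < p * (1 / x n) := by positivity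
    have h4 : p * (1 / x n) ≤ I := by nlinarith
    constructor
    · rw [div_le_iff₀ hIpos]
      rw [mul_one_div, div_le_iff₀ ha] at h4
      linarith
    · nlinarith
  exact ⟨p / I, I, by positivity, (key 0).1.trans (key 0).2, key⟩
end

section
/- Let x : ℕ → ℚ be the sequence defined by x₀ = x₁ = x₂ = x₃ = 1 and x_{n+4} = (1 + x_{n+3} + x_{n+2} + x_{n+1})/x_n for all n ≥ 0 (all terms are positive rationals, so the recursion is well defined). Then x_n ≠ 1 for all n with 4 ≤ n ≤ 1003. Consequently, the sequence x is not periodic with any period d satisfying 1 ≤ d ≤ 1000 (i.e. there is no d in that range with x_{n+d} = x_n for all n). -/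
/-- `q` is a quotient of positive naturals with residues `r`, `s` modulo `100003`. -/
def LRes (q : ℚ) (r s : ℕ) : Prop :=
  ∃ u v : ℕ, 0 < u ∧ 0 < v ∧ q = (u : ℚ) / v ∧ u % 100003 = r ∧ v % 100003 = s

theorem LRes.ne_one {q : ℚ} {r s : ℕ} (h : LRes q r s) (hrs : r ≠ s) : q ≠ 1 := by
  obtain ⟨u, v, hu, hv, rfl, rfl, rfl⟩ := h
  intro h
  apply hrs
  have hv' : (v : ℚ) ≠ 0 := by positivity
  rw [div_eq_one_iff_eq hv'] at h
  have : u = v := by exact_mod_cast h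
  rw [this]

/-- Next numerator modulo `100003`. -/
def nextNum (s0 r1 s1 r2 s2 r3 s3 : ℕ) : ℕ :=
  ((s1 * s2 * s3 + s1 * s2 * r3 + s1 * r2 * s3 + r1 * s2 * s3) * s0) % 100003

/-- Next denominator modulo `100003`. -/
def nextDen (r0 s1 s2 s3 : ℕ) : ℕ := (s1 * s2 * s3 * r0) % 100003

theorem LRes.step {q0 q1 q2 q3 : ℚ} {r0 s0 r1 s1 r2 s2 r3 s3 : ℕ}
    (h0 : LRes q0 r0 s0) (h1 : LRes q1 r1 s1) (h2 : LRes q2 r2 s2) (h3 : LRes q3 r3 s3) :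
    LRes ((1 + q3 + q2 + q1) / q0) (nextNum s0 r1 s1 r2 s2 r3 s3) (nextDen r0 s1 s2 s3) := by
  obtain ⟨u0, v0, hu0, hv0, rfl, rfl, rfl⟩ := h0
  obtain ⟨u1, v1, hu1, hv1, rfl, rfl, rfl⟩ := h1
  obtain ⟨u2, v2, hu2, hv2, rfl, rfl, rfl⟩ := h2
  obtain ⟨u3, v3, hu3, hv3, rfl, rfl, rfl⟩ := h3
  refine ⟨(v1 * v2 * v3 + v1 * v2 * u3 + v1 * u2 * v3 + u1 * v2 * v3) * v0,
    v1 * v2 * v3 * u0, by positivity, by positivity, ?_, ?_, ?_⟩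
  · push_cast
    field_simp
  · simp [nextNum, Nat.add_mod, Nat.mul_mod]
  · simp [nextDen, Nat.mul_mod]

/-- Evaluate `n` to a numeral before continuing with `f`. -/
def forceNat (n : ℕ) (f : ℕ → Bool) : Bool :=
  Nat.rec (motive := fun _ => Bool) (f 0) (fun m _ => f (m + 1)) n

theorem forceNat_eq (n : ℕ) (f : ℕ → Bool) : forceNat n f = f n := by
  cases n <;> rfl

/-- Check that the next `k` terms are different from `1` modulo `100003`. -/
def checkRes : ℕ → ℕ → ℕ → ℕ → ℕ → ℕ → ℕ → ℕ → ℕ → Bool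
  | 0, _, _, _, _, _, _, _, _ => true
  | k + 1, r0, s0, r1, s1, r2, s2, r3, s3 =>
    forceNat (nextNum s0 r1 s1 r2 s2 r3 s3) fun r =>
      forceNat (nextDen r0 s1 s2 s3) fun s =>
        bif Nat.beq r s then false else checkRes k r1 s1 r2 s2 r3 s3 r s

theorem checkRes_sound (x : ℕ → ℚ)
    (hrec : ∀ n : ℕ, x (n + 4) = (1 + x (n + 3) + x (n + 2) + x (n + 1)) / x n) (k : ℕ) :
    ∀ (n r0 s0 r1 s1 r2 s2 r3 s3 : ℕ), LRes (x n) r0 s0 → LRes (x (n + 1)) r1 s1 →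
      LRes (x (n + 2)) r2 s2 → LRes (x (n + 3)) r3 s3 →
      checkRes k r0 s0 r1 s1 r2 s2 r3 s3 = true → ∀ j, j < k → x (n + 4 + j) ≠ 1 := by
  induction k with
  | zero => intros; omega
  | succ k ih =>
    intro n r0 s0 r1 s1 r2 s2 r3 s3 h0 h1 h2 h3 hc j hj
    have h4 := LRes.step h0 h1 h2 h3
    rw [← hrec] at h4
    rw [checkRes, forceNat_eq, forceNat_eq] at hc
    cases hb : Nat.beq (nextNum s0 r1 s1 r2 s2 r3 s3) (nextDen r0 s1 s2 s3) with
    | true => simp [hb] at hc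
    | false =>
      rw [hb, cond_false] at hc
      cases j with
      | zero => exact h4.ne_one (Nat.ne_of_beq_eq_false hb)
      | succ j =>
        have := ih (n + 1) _ _ _ _ _ _ _ _ h1 h2 h3 h4 hc j (by omega)
        rwa [show n + 1 + 4 + j = n + 4 + (j + 1) by omega] at this

set_option maxRecDepth 100000 in
theorem checkRes_true : checkRes 1000 1 1 1 1 1 1 1 1 = true := by
  decide +kernel


/-- For the fourth-order Lyness-type equation
`x_{n+4} = (1 + x_{n+3} + x_{n+2} + x_{n+1})/x_n` started from `1,1,1,1`, the
value `1` does not recur among terms `x_4, …, x_1003`, so the sequence has no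
period `d` with `1 ≤ d ≤ 1000`. -/
theorem fourth_order_not_periodic (x : ℕ → ℚ)
    (h0 : x 0 = 1) (h1 : x 1 = 1) (h2 : x 2 = 1) (h3 : x 3 = 1)
    (hrec : ∀ n : ℕ, x (n + 4) = (1 + x (n + 3) + x (n + 2) + x (n + 1)) / x n) :
    (∀ n : ℕ, 4 ≤ n → n ≤ 1003 → x n ≠ 1) ∧
    ¬ ∃ d : ℕ, 1 ≤ d ∧ d ≤ 1000 ∧ ∀ n : ℕ, x (n + d) = x n := by
  have one : ∀ q : ℚ, q = 1 → LRes q 1 1 := fun q hq =>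
    ⟨1, 1, one_pos, one_pos, by simp [hq], rfl, rfl⟩
  have key : ∀ n : ℕ, 4 ≤ n → n ≤ 1003 → x n ≠ 1 := by
    intro n hn hn'
    have := checkRes_sound x hrec 1000 0 1 1 1 1 1 1 1 1 (one _ h0) (one _ h1) (one _ h2)
      (one _ h3) checkRes_true (n - 4) (by omega)
    rwa [show 0 + 4 + (n - 4) = n by omega] at this
  refine ⟨key, ?_⟩
  rintro ⟨d, hd, hd', h⟩
  exact key (3 + d) (by omega) (by omega) ((h 3).trans h3)
end
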